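/- For every m ≥ 1 and n ≥ 1, if E ⊆ ℝ^m has computable measure 0, then E × ℝ^n ⊆ ℝ^{m+n} has computable measure 0. -/

import Mathlib

open MeasureTheory Filter

/-- The dyadic cube `Q_r(u)` in `ℝ^n`. -/
def dyadicCube (n r : ℕ) (u : Fin n → ℤ) : Set (Fin n → ℝ) :=
  {x | ∀ i, (u i : ℝ) * 2 ^ (-(r : ℤ)) ≤ x i ∧ x i < ((u i : ℝ) + 1) * 2 ^ (-(r : ℤ))}

/-- `u` indexes an `r`-dyadic cube inside `[0,1)^n`. -/
def validIndex (r : ℕ) {n : ℕ} (u : Fin n → ℤ) : Prop := ∀ i, 0 ≤ u i ∧ u i < 2 ^ r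

/-- A martingale on `[0,1)^n`, presented as a nonnegative function on dyadic-cube
indices satisfying the fairness (averaging) condition on cubes inside `[0,1)^n`. -/
structure DyadicMartingale (n : ℕ) where
  toFun : ℕ → (Fin n → ℤ) → ℝ
  nonneg : ∀ r u, 0 ≤ toFun r u
  fair : ∀ r u, validIndex r u →
    toFun r u = (2 : ℝ) ^ (-(n : ℤ)) *
      ∑ a : Fin n → Bool, toFun (r + 1) (fun i => 2 * u i + if a i then 1 else 0)

/-- The index of the unique `r`-dyadic cube containing `x ∈ [0,1)^n`. -/
noncomputable def dyadicIndex (n r : ℕ) (x : Fin n → ℝ) : Fin n → ℤ := fun i => ⌊x i * 2 ^ r⌋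

/-- `d` succeeds at `x`: `limsup_r d^{(r)}(x) = ∞`. -/
def succeedsAt {n : ℕ} (d : DyadicMartingale n) (x : Fin n → ℝ) : Prop :=
  Filter.atTop.limsup (fun r => ((d.toFun r (dyadicIndex n r x) : ℝ) : EReal)) = ⊤

/-- The unit cube `[0,1)^n`. -/
def unitCube (n : ℕ) : Set (Fin n → ℝ) := {x | ∀ i, 0 ≤ x i ∧ x i < 1}

/-- `E^# = [0,1)^n ∩ ⋃_{t ∈ ℤ^n} (E + t)`. -/
def sharp {n : ℕ} (E : Set (Fin n → ℝ)) : Set (Fin n → ℝ) :=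
  unitCube n ∩ ⋃ t : Fin n → ℤ, (fun x => x + fun i => (t i : ℝ)) '' E

/-- A martingale is computable if its values can be uniformly computably
approximated to within `2^{-s}` by rationals. -/
def DyadicMartingale.IsComputable {n : ℕ} (d : DyadicMartingale n) : Prop :=
  ∃ dh : ℕ × ℕ × (Fin n → ℤ) → ℚ,
    Computable dh ∧ (∀ p, 0 ≤ dh p) ∧
    ∀ s r u, validIndex r u →
      |(dh (s, r, u) : ℝ) - d.toFun r u| ≤ 2 ^ (-(s : ℤ))

/-- `E ⊆ ℝ^n` has computable measure 0. -/
def HasComputableMeasureZero {n : ℕ} (E : Set (Fin n → ℝ)) : Prop :=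
  ∃ d : DyadicMartingale n, d.IsComputable ∧ ∀ x ∈ sharp E, succeedsAt d x

/-- `x ∈ ℝ^n` is computably random: no computable martingale succeeds at the
unique translate `x + t ∈ [0,1)^n` with `t ∈ ℤ^n`. -/
def ComputablyRandom {n : ℕ} (x : Fin n → ℝ) : Prop :=
  ∀ d : DyadicMartingale n, d.IsComputable → ¬ succeedsAt d (fun i => Int.fract (x i))

/-- Precomposition of a tuple with a map of finite index types is primitive recursive. -/
theorem primrec_fin_precomp {α : Type*} [Primcodable α] {m k : ℕ} (f : Fin m → Fin k) :
    Primrec (fun (u : Fin k → α) (i : Fin m) => u (f i)) := by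
  have h : Primrec₂ (fun (u : Fin k → α) (i : Fin m) => u (f i)) :=
    Primrec.fin_app.comp₂ Primrec₂.left ((Primrec.dom_finite f).comp₂ Primrec₂.right)
  exact Primrec.fin_curry.2 h

/-- Summing over `Fin (m + n) → Bool` a function of the first `m` coordinates. -/
theorem sum_comp_castAdd (m n : ℕ) (F : (Fin m → Bool) → ℝ) :
    ∑ a : Fin (m + n) → Bool, F (fun i => a (Fin.castAdd n i)) =
      2 ^ n * ∑ a : Fin m → Bool, F a := by
  rw [← (Fin.appendEquiv (α := Bool) m n).sum_comp, Fintype.sum_prod_type, Finset.mul_sum]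
  simp [Fin.appendEquiv]

/-- The martingale on `[0,1)^(m+n)` that bets on the first `m` coordinates only. -/
def DyadicMartingale.cylinder {m : ℕ} (d : DyadicMartingale m) (n : ℕ) :
    DyadicMartingale (m + n) where
  toFun r u := d.toFun r (fun i => u (Fin.castAdd n i))
  nonneg r u := d.nonneg r _
  fair r u hu := by
    rw [d.fair r _ (fun i => hu _), sum_comp_castAdd m n
      (fun a => d.toFun (r + 1) (fun i => 2 * u (Fin.castAdd n i) + if a i then 1 else 0)),
      ← mul_assoc]
    congr 1
    rw [← zpow_natCast (2 : ℝ) n, ← zpow_add₀ two_ne_zero]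
    congr 1
    push_cast
    ring

theorem DyadicMartingale.IsComputable.cylinder {m : ℕ} {d : DyadicMartingale m}
    (hd : d.IsComputable) (n : ℕ) : (d.cylinder n).IsComputable := by
  obtain ⟨dh, hc, h0, happrox⟩ := hd
  refine ⟨fun p => dh (p.1, p.2.1, fun i => p.2.2 (Fin.castAdd n i)), ?_, fun p => h0 _,
    fun s r u hu => happrox s r _ (fun i => hu _)⟩
  exact hc.comp (Computable.fst.pair ((Computable.fst.comp Computable.snd).pair
    ((primrec_fin_precomp (Fin.castAdd n)).to_comp.comp (Computable.snd.comp Computable.snd))))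

theorem sharp_prod_univ_castAdd {m n : ℕ} {E : Set (Fin m → ℝ)} {z : Fin (m + n) → ℝ}
    (hz : z ∈ sharp {z : Fin (m + n) → ℝ | (fun i : Fin m => z (Fin.castAdd n i)) ∈ E}) :
    (fun i : Fin m => z (Fin.castAdd n i)) ∈ sharp E := by
  obtain ⟨hcube, hz⟩ := hz
  obtain ⟨t, x, hx, rfl⟩ := Set.mem_iUnion.1 hz
  exact ⟨fun i => hcube _, Set.mem_iUnion.2 ⟨fun i => t (Fin.castAdd n i), _, hx, rfl⟩⟩

/-- If `E ⊆ ℝ^m` has computable measure 0, then so does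
`E × ℝ^n ⊆ ℝ^{m+n}`. -/
theorem hasComputableMeasureZero_prod_univ
    (m n : ℕ) (hm : 1 ≤ m) (hn : 1 ≤ n) (E : Set (Fin m → ℝ))
    (hE : HasComputableMeasureZero E) :
    HasComputableMeasureZero
      {z : Fin (m + n) → ℝ | (fun i : Fin m => z (Fin.castAdd n i)) ∈ E} := by
  obtain ⟨d, hd, hsucc⟩ := hE
  exact ⟨d.cylinder n, hd.cylinder n, fun z hz => hsucc _ (sharp_prod_univ_castAdd hz)⟩
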